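/- Fix an integer n ≥ 2 and reals 0 < τ₀ < ν < 1/(2n). Then there exists τ₁ ∈ (0, τ₀] such that for every real X ≥ 1, every g₁ ∈ K₁(X, τ₁) and every g₂ ∈ K₁(X, τ₀), the product g₁·g₂ lies in K₁(X, ν). -/

import Mathlib

noncomputable section

/-- The archimedean congruence subset `K₁(X,τ)` inside `GL_n(ℝ)`, encoded as a set of
`n × n` real matrices (given as functions): in block form `[[a,b],[c,d]]` with `a` of
size `(n-1) × (n-1)`, the matrix and its top-left block are invertible,
`|a - 1| < τ`, `|b| < τ`, `|c| < τ/X` and `|d - 1| < τ/X` entrywise. -/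
def K1 (n : ℕ) (X τ : ℝ) : Set (Fin n → Fin n → ℝ) :=
  {g | IsUnit (Matrix.of g).det ∧
       IsUnit (Matrix.of fun i j : Fin (n - 1) =>
         g (Fin.castLE (Nat.sub_le n 1) i) (Fin.castLE (Nat.sub_le n 1) j)).det ∧
       (∀ i j : Fin n, i.val < n - 1 → j.val < n - 1 →
          |g i j - (if i = j then 1 else 0)| < τ) ∧
       (∀ i j : Fin n, i.val < n - 1 → j.val = n - 1 → |g i j| < τ) ∧
       (∀ i j : Fin n, i.val = n - 1 → j.val < n - 1 → |g i j| < τ / X) ∧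
       (∀ i j : Fin n, i.val = n - 1 → j.val = n - 1 → |g i j - 1| < τ / X)}

/-- Matrix multiplication on matrices encoded as functions. -/
def mulG (n : ℕ) (g h : Fin n → Fin n → ℝ) : Fin n → Fin n → ℝ :=
  fun i j => ∑ k, g i k * h k j

/-- A real matrix that is entrywise close to the identity has invertible determinant, by strict
diagonal dominance. -/
theorem isUnit_det_of_abs_sub_one_lt {m : ℕ} (A : Matrix (Fin m) (Fin m) ℝ) {ν : ℝ}
    (hν : (m : ℝ) * ν ≤ 1) (hA : ∀ i j, |A i j - (if i = j then 1 else 0)| < ν) :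
    IsUnit A.det := by
  rw [isUnit_iff_ne_zero]
  refine det_ne_zero_of_sum_row_lt_diag fun k => ?_
  have hsum : ∑ j, |A k j - (if k = j then 1 else 0)| < (m : ℝ) * ν := by
    have := Finset.sum_lt_sum_of_nonempty (s := Finset.univ) ⟨k, Finset.mem_univ k⟩
      (fun j _ => hA k j)
    simpa using this
  rw [← Finset.sum_erase_add _ _ (Finset.mem_univ k)] at hsum
  have hoff : ∑ j ∈ Finset.univ.erase k, |A k j - (if k = j then 1 else 0)|
      = ∑ j ∈ Finset.univ.erase k, ‖A k j‖ :=
    Finset.sum_congr rfl fun j hj => by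
      rw [if_neg (Finset.ne_of_mem_erase hj).symm, sub_zero, Real.norm_eq_abs]
  rw [hoff, if_pos rfl] at hsum
  have hdiag : 1 - |A k k - 1| ≤ ‖A k k‖ := by
    have := abs_sub_abs_le_abs_sub 1 (A k k)
    rw [abs_one, abs_sub_comm] at this
    rw [Real.norm_eq_abs]
    linarith
  linarith

/-- The weight of the `i`-th row in the bounds defining `K1`. -/
def rowWeight (n : ℕ) (X : ℝ) (i : Fin n) : ℝ :=
  if i.val < n - 1 then 1 else X⁻¹

theorem rowWeight_pos {n : ℕ} {X : ℝ} (hX : 1 ≤ X) (i : Fin n) : 0 < rowWeight n X i := by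
  unfold rowWeight
  split_ifs <;> positivity

theorem rowWeight_le_one {n : ℕ} {X : ℝ} (hX : 1 ≤ X) (i : Fin n) : rowWeight n X i ≤ 1 := by
  unfold rowWeight
  split_ifs
  · exact le_rfl
  · exact inv_le_one_of_one_le₀ hX

theorem abs_sub_one_lt_of_mem_K1 {n : ℕ} {X τ : ℝ} {g : Fin n → Fin n → ℝ}
    (hg : g ∈ K1 n X τ) (i j : Fin n) :
    |g i j - (if i = j then 1 else 0)| < τ * rowWeight n X i := by
  obtain ⟨-, -, ha, hb, hc, hd⟩ := hg
  unfold rowWeight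
  by_cases hi : i.val < n - 1 <;> by_cases hj : j.val < n - 1
  · simpa [hi] using ha i j hi hj
  · have hij : i ≠ j := by rintro rfl; exact hj hi
    simpa [hi, hij] using hb i j hi (by omega)
  · have hij : i ≠ j := by rintro rfl; exact hi hj
    simpa [hi, hij, div_eq_mul_inv] using hc i j (by omega) hj
  · have hij : i = j := Fin.ext (by omega)
    rw [if_neg hi, if_pos hij, ← div_eq_mul_inv]
    exact hd i j (by omega) (by omega)

theorem mem_K1_of_abs_sub_one_lt {n : ℕ} {X τ : ℝ} {g : Fin n → Fin n → ℝ} (hX : 1 ≤ X)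
    (hτ : 0 < τ) (hnτ : (n : ℝ) * τ ≤ 1)
    (hg : ∀ i j, |g i j - (if i = j then 1 else 0)| < τ * rowWeight n X i) :
    g ∈ K1 n X τ := by
  have hg' : ∀ i j, |g i j - (if i = j then 1 else 0)| < τ := fun i j =>
    (hg i j).trans_le (mul_le_of_le_one_right hτ.le (rowWeight_le_one hX i))
  refine ⟨isUnit_det_of_abs_sub_one_lt _ hnτ hg',
    isUnit_det_of_abs_sub_one_lt _ (ν := τ) ?_ fun i j => ?_, fun i j _ _ => hg' i j,
    fun i j hi hj => ?_, fun i j hi hj => ?_, fun i j hi hj => ?_⟩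
  · refine le_trans ?_ hnτ
    gcongr
    exact Nat.sub_le n 1
  · simpa [Fin.ext_iff] using
      hg' (Fin.castLE (Nat.sub_le n 1) i) (Fin.castLE (Nat.sub_le n 1) j)
  · have hij : i ≠ j := by rintro rfl; omega
    simpa [hij] using hg' i j
  · have hij : i ≠ j := by rintro rfl; omega
    simpa [rowWeight, hi, hij, div_eq_mul_inv] using hg i j
  · have hij : i = j := Fin.ext (by omega)
    have := hg i j
    rwa [if_pos hij, rowWeight, if_neg hi.not_lt, ← div_eq_mul_inv] at this

theorem mulG_sub_one (n : ℕ) (g h : Fin n → Fin n → ℝ) (i j : Fin n) :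
    mulG n g h i j - (if i = j then 1 else 0)
      = (g i j - (if i = j then 1 else 0)) + (h i j - (if i = j then 1 else 0))
        + ∑ k, (g i k - (if i = k then 1 else 0)) * (h k j - (if k = j then 1 else 0)) := by
  simp only [mulG, sub_mul, mul_sub, Finset.sum_sub_distrib, mul_ite, mul_one, mul_zero,
    ite_mul, one_mul, zero_mul, Finset.sum_ite_eq, Finset.sum_ite_eq', Finset.mem_univ, if_true]
  ring

/-- The containment `K₁(X,τ₁) · K₁(X,τ₀) ⊆ K₁(X,ν)` from the proof of Lemma 1.2:
for `0 < τ₀ < ν < 1/(2n)` there is `τ₁ ∈ (0,τ₀]` such that for every `X ≥ 1`,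
`g₁ ∈ K₁(X,τ₁)` and `g₂ ∈ K₁(X,τ₀)`, the product `g₁·g₂` lies in `K₁(X,ν)`. -/
theorem mul_K1_subset (n : ℕ) (hn : 2 ≤ n) (τ₀ ν : ℝ)
    (h1 : 0 < τ₀) (h2 : τ₀ < ν) (h3 : ν < 1 / (2 * (n : ℝ))) :
    ∃ τ₁ : ℝ, 0 < τ₁ ∧ τ₁ ≤ τ₀ ∧ ∀ X : ℝ, 1 ≤ X →
      ∀ g₁ ∈ K1 n X τ₁, ∀ g₂ ∈ K1 n X τ₀, mulG n g₁ g₂ ∈ K1 n X ν := by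
  have hn0 : (0 : ℝ) < n := by exact_mod_cast (by omega : 0 < n)
  have hν : (n : ℝ) * ν < 1 / 2 := by
    rw [lt_div_iff₀ (by positivity)] at h3
    linarith
  have hτ₀ : (n : ℝ) * τ₀ < 1 / 2 := (mul_lt_mul_of_pos_left h2 hn0).trans hν
  refine ⟨min τ₀ ((ν - τ₀) / 2), lt_min h1 (by linarith), min_le_left _ _, ?_⟩
  have hpos : 0 < min τ₀ ((ν - τ₀) / 2) := lt_min h1 (by linarith)
  have hle : min τ₀ ((ν - τ₀) / 2) ≤ (ν - τ₀) / 2 := min_le_right _ _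
  generalize min τ₀ ((ν - τ₀) / 2) = τ₁ at hpos hle
  intro X hX g₁ hg₁ g₂ hg₂
  refine mem_K1_of_abs_sub_one_lt hX (h1.trans h2) (by linarith) fun i j => ?_
  have hw := rowWeight_pos hX i
  have e₁ := abs_sub_one_lt_of_mem_K1 hg₁
  have e₂ := abs_sub_one_lt_of_mem_K1 hg₂
  have hsum : |∑ k, (g₁ i k - (if i = k then 1 else 0)) * (g₂ k j - (if k = j then 1 else 0))|
      ≤ n * (τ₁ * rowWeight n X i * τ₀) := by
    refine (Finset.abs_sum_le_sum_abs _ _).trans ?_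
    refine (Finset.sum_le_card_nsmul _ _ (τ₁ * rowWeight n X i * τ₀) fun k _ => ?_).trans
      (by simp)
    rw [abs_mul]
    exact mul_le_mul (e₁ i k).le
      ((e₂ k j).le.trans (mul_le_of_le_one_right h1.le (rowWeight_le_one hX k)))
      (abs_nonneg _) (by positivity)
  rw [mulG_sub_one]
  refine (abs_add_three _ _ _).trans_lt ?_
  calc _ < τ₁ * rowWeight n X i + τ₀ * rowWeight n X i + n * (τ₁ * rowWeight n X i * τ₀) :=
        add_lt_add_of_lt_of_le (add_lt_add (e₁ i j) (e₂ i j)) hsum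
    _ = (τ₁ + τ₀ + (n * τ₀) * τ₁) * rowWeight n X i := by ring
    _ ≤ ν * rowWeight n X i := by
        gcongr
        have := mul_lt_mul_of_pos_right hτ₀ hpos
        linarith
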